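/- Let R ≥ 1 be a natural number, let a_r ∈ ℝ^{P_in} be vectors for r ∈ {1,…,R}, let D ∈ ℝ^{P_out×C} be a fixed matrix, and let S ∈ ℝ^{C×C} be symmetric positive definite. Then, for a single data point (N = 1) whose per-row transposed Jacobians are a_r ⊗ D (independent of r in the second factor, as for the query-projection layer of a simplified attention block), K-FAC-expand is exact: Σ_{r=1}^R (a_r ⊗ D) · S⁻¹ · (a_r ⊗ D)ᵀ = [ (1/R) Σ_{r=1}^R a_r a_rᵀ ] ⊗ [ R • (D · S⁻¹ · Dᵀ) ]. -/

import Mathlib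

open Matrix Kronecker

/-- Kronecker product of a column vector `a ∈ ℝ^p` (identified with a `p × 1`
column matrix) with an `s × t` matrix `B`, yielding a `(p·s) × t` matrix. -/
def vecKron {p s t : ℕ} (a : Fin p → ℝ) (B : Matrix (Fin s) (Fin t) ℝ) :
    Matrix (Fin p × Fin s) (Fin t) ℝ :=
  Matrix.of fun q k => a q.1 * B q.2 k

/-- A congruence by `a ⊗ D` factors as the Kronecker product of `a aᵀ` and the congruence
by `D`. -/
theorem vecKron_mul_mul_transpose {p s t : ℕ} (a : Fin p → ℝ)
    (D : Matrix (Fin s) (Fin t) ℝ) (M : Matrix (Fin t) (Fin t) ℝ) :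
    vecKron a D * M * (vecKron a D)ᵀ = vecMulVec a a ⊗ₖ (D * M * Dᵀ) := by
  ext ⟨i, j⟩ ⟨k, l⟩
  simp only [vecKron, mul_apply, transpose_apply, of_apply, kroneckerMap_apply, vecMulVec_apply,
    Finset.mul_sum, Finset.sum_mul]
  refine Finset.sum_congr rfl fun x _ => Finset.sum_congr rfl fun y _ => ?_
  ring

/-- Exactness of K-FAC-expand for a single data point (`N = 1`) when the
per-row transposed Jacobians are `a_r ⊗ D` with `D` independent of `r`, as for
the query-projection layer of a simplified attention block, with a Gaussian
likelihood. -/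
theorem kfac_expand_exact_single_datapoint_attention_query
    (R Pin Pout C : ℕ) (hR : 1 ≤ R)
    (a : Fin R → (Fin Pin → ℝ))
    (D : Matrix (Fin Pout) (Fin C) ℝ)
    (S : Matrix (Fin C) (Fin C) ℝ) (hS : S.PosDef) :
    ∑ r, vecKron (a r) D * S⁻¹ * (vecKron (a r) D)ᵀ
      = ((1 / (R : ℝ)) • ∑ r, vecMulVec (a r) (a r)) ⊗ₖ
          ((R : ℝ) • (D * S⁻¹ * Dᵀ)) := by
  have hR0 : (R : ℝ) ≠ 0 := Nat.cast_ne_zero.mpr (by omega)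
  simp only [vecKron_mul_mul_transpose]
  rw [smul_kronecker, kronecker_smul, smul_smul, one_div_mul_cancel hR0, one_smul]
  ext ⟨i, j⟩ ⟨k, l⟩
  simp only [Matrix.sum_apply, kroneckerMap_apply, Finset.sum_mul]
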